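/- Let λ ≥ 2 be an integer and let G be a connected sesqui-regular graph with parameters (v, k, c) whose smallest adjacency eigenvalue is at least −λ. Then there exists a constant C(λ) depending only on λ such that if k ≥ C(λ), then either c ≤ λ²(λ−1) or v − k − 1 ≤ (λ−1)²/4 + 1. -/

import Mathlib

open Matrix Filter

/-- The smallest eigenvalue of a real matrix (infimum of its spectrum). -/
noncomputable def minEigM {n : Type*} [Fintype n] [DecidableEq n] (A : Matrix n n ℝ) : ℝ :=
  sInf (spectrum ℝ A)

/-- The largest eigenvalue of a real matrix (supremum of its spectrum). -/
noncomputable def maxEigM {n : Type*} [Fintype n] [DecidableEq n] (A : Matrix n n ℝ) : ℝ :=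
  sSup (spectrum ℝ A)

/-- The smallest adjacency eigenvalue of a finite simple graph. -/
noncomputable def graphMinEig {V : Type*} [Fintype V] [DecidableEq V] (G : SimpleGraph V) : ℝ := by
  classical exact minEigM (G.adjMatrix ℝ)

/-- The largest adjacency eigenvalue of a finite simple graph. -/
noncomputable def graphMaxEig {V : Type*} [Fintype V] [DecidableEq V] (G : SimpleGraph V) : ℝ := by
  classical exact maxEigM (G.adjMatrix ℝ)

/-- A sesqui-regular graph with parameters `(v, k, c)`: `k`-regular on `v` vertices,
and any two vertices at distance 2 have exactly `c` common neighbors. -/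
def IsSesquiRegular {V : Type*} [Fintype V] (G : SimpleGraph V) (v k c : ℕ) : Prop :=
  Fintype.card V = v ∧ (∀ x : V, (G.neighborSet x).ncard = k) ∧
    ∀ x y : V, G.dist x y = 2 → (G.commonNeighbors x y).ncard = c

set_option linter.unusedSectionVars false

section QuadraticForm

variable {V : Type*} [Fintype V] [DecidableEq V]

/-- The adjacency matrix shifted by `t` is positive semidefinite as a quadratic form. -/
def ShiftedFormNonneg (G : SimpleGraph V) [DecidableRel G.Adj] (t : ℝ) : Prop :=
  ∀ f : V → ℝ, 0 ≤ f ⬝ᵥ (G.adjMatrix ℝ *ᵥ f) + t * (f ⬝ᵥ f)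

theorem shiftedFormNonneg_of_le_graphMinEig (G : SimpleGraph V) [DecidableRel G.Adj] {t : ℝ}
    (h : -t ≤ graphMinEig G) : ShiftedFormNonneg G t := by
  have hm : graphMinEig G = sInf (spectrum ℝ (G.adjMatrix ℝ)) := by
    unfold graphMinEig minEigM
    congr!
  have hH : (G.adjMatrix ℝ).IsHermitian := by
    simp [Matrix.IsHermitian, Matrix.conjTranspose_eq_transpose_of_trivial]
  have hspec : ∀ x ∈ spectrum ℝ (G.adjMatrix ℝ), -t ≤ x := fun x hx =>
    h.trans (hm ▸ csInf_le (Matrix.finite_real_spectrum).bddBelow hx)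
  have hH' : (G.adjMatrix ℝ + algebraMap ℝ (Matrix V V ℝ) t).IsHermitian := by
    refine hH.add ?_
    simp [Matrix.IsHermitian, Matrix.algebraMap_eq_diagonal]
  have hpsd : (G.adjMatrix ℝ + algebraMap ℝ (Matrix V V ℝ) t).PosSemidef := by
    rw [hH'.posSemidef_iff_eigenvalues_nonneg]
    intro i
    have hi := hH'.eigenvalues_mem_spectrum_real i
    rw [← spectrum.add_singleton_eq] at hi
    obtain ⟨x, hx, y, hy, hxy⟩ := Set.mem_add.1 hi
    have := hspec x hx
    rw [Set.mem_singleton_iff] at hy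
    simp only [Pi.zero_apply]
    linarith
  intro f
  have := hpsd.dotProduct_mulVec_nonneg f
  simpa [Matrix.add_mulVec, dotProduct_add, Algebra.algebraMap_eq_smul_one,
    Matrix.smul_mulVec] using this

/-- The indicator vector of a finite set of vertices. -/
def indVec (S : Finset V) : V → ℝ := fun x => if x ∈ S then 1 else 0

/-- The number of ordered pairs of adjacent vertices in `S × T`. -/
def edgeCount (G : SimpleGraph V) [DecidableRel G.Adj] (S T : Finset V) : ℝ :=
  ∑ x ∈ S, ∑ y ∈ T, if G.Adj x y then 1 else 0

variable {G : SimpleGraph V} [DecidableRel G.Adj] {S T U : Finset V}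

theorem edgeCount_eq_sum_card :
    edgeCount G S T = ∑ x ∈ S, ((T.filter (G.Adj x)).card : ℝ) := by
  simp [edgeCount]

theorem edgeCount_comm : edgeCount G S T = edgeCount G T S := by
  unfold edgeCount
  rw [Finset.sum_comm]
  simp [G.adj_comm]

theorem edgeCount_le_mul {m : ℕ} (h : ∀ x ∈ S, (T.filter (G.Adj x)).card ≤ m) :
    edgeCount G S T ≤ S.card * m := by
  rw [edgeCount_eq_sum_card, ← nsmul_eq_mul]
  exact Finset.sum_le_card_nsmul _ _ _ fun x hx => by exact_mod_cast h x hx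

theorem edgeCount_le_card_mul_card : edgeCount G S T ≤ S.card * T.card :=
  edgeCount_le_mul fun _ _ => Finset.card_filter_le _ _

theorem edgeCount_eq_card_mul_card (h : ∀ x ∈ S, ∀ y ∈ T, G.Adj x y) :
    edgeCount G S T = S.card * T.card := by
  unfold edgeCount
  rw [Finset.sum_congr rfl fun x hx => Finset.sum_congr rfl fun y hy => if_pos (h x hx y hy)]
  simp

theorem edgeCount_eq_zero (h : ∀ x ∈ S, ∀ y ∈ T, ¬ G.Adj x y) : edgeCount G S T = 0 :=
  Finset.sum_eq_zero fun x hx => Finset.sum_eq_zero fun y hy => if_neg (h x hx y hy)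

theorem edgeCount_self_le : edgeCount G S S ≤ S.card * (S.card - 1) := by
  rw [edgeCount_eq_sum_card, ← nsmul_eq_mul]
  refine Finset.sum_le_card_nsmul _ _ _ fun x hx => ?_
  have : (S.filter (G.Adj x)).card < S.card := by
    refine Finset.card_lt_card (Finset.filter_ssubset.2 ⟨x, hx, G.irrefl⟩)
  have : (S.filter (G.Adj x)).card + 1 ≤ S.card := this
  have : ((S.filter (G.Adj x)).card : ℝ) + 1 ≤ S.card := by exact_mod_cast this
  linarith

theorem edgeCount_singleton_self (x : V) : edgeCount G {x} {x} = 0 :=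
  edgeCount_eq_zero (by simp)

theorem edgeCount_biUnion_left {ι : Type*} [DecidableEq ι] {I : Finset ι} {F : ι → Finset V}
    (h : Set.PairwiseDisjoint (I : Set ι) F) :
    edgeCount G (I.biUnion F) T = ∑ i ∈ I, edgeCount G (F i) T :=
  Finset.sum_biUnion h

theorem edgeCount_biUnion_right {ι : Type*} [DecidableEq ι] {I : Finset ι} {F : ι → Finset V}
    (h : Set.PairwiseDisjoint (I : Set ι) F) :
    edgeCount G S (I.biUnion F) = ∑ i ∈ I, edgeCount G S (F i) := by
  simp only [edgeCount_comm (S := S), edgeCount_biUnion_left h]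

theorem indVec_dotProduct_indVec : indVec S ⬝ᵥ indVec T = ((S ∩ T).card : ℝ) := by
  simp [indVec, dotProduct, Finset.inter_comm]

theorem indVec_dotProduct_mulVec_indVec :
    indVec S ⬝ᵥ (G.adjMatrix ℝ *ᵥ indVec T) = edgeCount G S T := by
  simp only [indVec, edgeCount, dotProduct, Matrix.mulVec, SimpleGraph.adjMatrix_apply, mul_ite,
    ite_mul, one_mul, zero_mul, mul_one, mul_zero]
  rw [← Finset.sum_filter, Finset.filter_mem_eq_inter, Finset.univ_inter]
  refine Finset.sum_congr rfl fun x _ => ?_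
  rw [← Finset.sum_filter, Finset.filter_mem_eq_inter, Finset.univ_inter]

theorem ShiftedFormNonneg.three_sets {t : ℝ} (hG : ShiftedFormNonneg G t)
    (hST : Disjoint S T) (hSU : Disjoint S U) (hTU : Disjoint T U) (a b e : ℝ) :
    0 ≤ a ^ 2 * edgeCount G S S + b ^ 2 * edgeCount G T T + e ^ 2 * edgeCount G U U
      + 2 * (a * b) * edgeCount G S T + 2 * (a * e) * edgeCount G S U
      + 2 * (b * e) * edgeCount G T U
      + t * (a ^ 2 * S.card + b ^ 2 * T.card + e ^ 2 * U.card) := by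
  have h := hG (a • indVec S + b • indVec T + e • indVec U)
  simp only [Matrix.mulVec_add, Matrix.mulVec_smul, dotProduct_add, add_dotProduct,
    dotProduct_smul, smul_dotProduct, indVec_dotProduct_mulVec_indVec, indVec_dotProduct_indVec,
    smul_eq_mul, Finset.inter_self, Finset.inter_comm T S, Finset.inter_comm U S,
    Finset.inter_comm U T, Finset.disjoint_iff_inter_eq_empty.1 hST,
    Finset.disjoint_iff_inter_eq_empty.1 hSU, Finset.disjoint_iff_inter_eq_empty.1 hTU,
    edgeCount_comm (S := T) (T := S), edgeCount_comm (S := U) (T := S),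
    edgeCount_comm (S := U) (T := T), Finset.card_empty, Nat.cast_zero] at h
  linarith

end QuadraticForm

section CliqueExtensions

variable {V : Type*} [Fintype V] [DecidableEq V] {G : SimpleGraph V} [DecidableRel G.Adj]

theorem ShiftedFormNonneg.card_mul_card_le {m : ℕ} (hG : ShiftedFormNonneg G (m + 1))
    {y : V} {W U : Finset V} (hW : ∀ w ∈ W, G.Adj y w) (hU : ∀ u ∈ U, ¬ G.Adj y u) (hy : y ∉ U)
    (hWU : ∀ w ∈ W, ∀ u ∈ U, G.Adj w u) :
    W.card * U.card ≤ (m + 1) * m * (W.card + U.card) := by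
  rcases W.card.eq_zero_or_pos with hp | hp
  · simp [hp]
  rcases U.card.eq_zero_or_pos with hq | hq
  · simp [hq]
  have h1 : Disjoint {y} W := by
    rw [Finset.disjoint_singleton_left]
    exact fun h => G.irrefl (hW y h)
  have h2 : Disjoint {y} U := by rwa [Finset.disjoint_singleton_left]
  have h3 : Disjoint W U := by
    rw [Finset.disjoint_left]
    exact fun x hx hx' => G.irrefl (hWU x hx x hx')
  have h := hG.three_sets h1 h2 h3 (-(W.card * U.card : ℝ)) ((m + 1) * U.card)
    (-((m + 1) * W.card))
  have eW := edgeCount_self_le (G := G) (S := W)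
  have eU := edgeCount_self_le (G := G) (S := U)
  have e1 : edgeCount G {y} W = W.card := by
    rw [edgeCount_eq_card_mul_card (by simpa using hW)]; simp
  have e2 : edgeCount G {y} U = 0 := edgeCount_eq_zero (by simpa using hU)
  rw [edgeCount_singleton_self, e1, e2, edgeCount_eq_card_mul_card hWU] at h
  simp only [Finset.card_singleton, Nat.cast_one] at h
  have hp' : (0 : ℝ) < W.card := by exact_mod_cast hp
  have hq' : (0 : ℝ) < U.card := by exact_mod_cast hq
  suffices (W.card * U.card : ℝ) ≤ (m + 1) * m * (W.card + U.card) by exact_mod_cast this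
  set p : ℝ := (W.card : ℝ)
  set q : ℝ := (U.card : ℝ)
  have eW' := mul_le_mul_of_nonneg_left eW (sq_nonneg ((m + 1 : ℝ) * q))
  have eU' := mul_le_mul_of_nonneg_left eU (sq_nonneg ((m + 1 : ℝ) * p))
  have key : 0 ≤ ((m + 1) * (p * q)) * ((m + 1) * m * (p + q) - p * q) := by
    nlinarith
  have hpos : 0 < ((m + 1) * (p * q)) := by positivity
  have := nonneg_of_mul_nonneg_right key hpos
  linarith

theorem ShiftedFormNonneg.card_le_sq_of_isIndepSet {t : ℕ} (ht : 0 < t) (hG : ShiftedFormNonneg G t)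
    {x : V} {I : Finset V} (hI : ∀ y ∈ I, G.Adj x y) (hI' : G.IsIndepSet (I : Set V)) :
    I.card ≤ t ^ 2 := by
  have h1 : Disjoint {x} I := by
    rw [Finset.disjoint_singleton_left]
    exact fun h => G.irrefl (hI x h)
  have h := hG.three_sets (U := ∅) h1 (by simp) (by simp) (-(I.card : ℝ)) t 0
  have e1 : edgeCount G {x} I = I.card := by
    rw [edgeCount_eq_card_mul_card (by simpa using hI)]; simp
  have e2 : edgeCount G I I = 0 := edgeCount_eq_zero fun a ha b hb hab =>
    hI' ha hb hab.ne hab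
  rw [edgeCount_singleton_self, e1, e2] at h
  simp only [Finset.card_singleton, Nat.cast_one, Finset.card_empty, Nat.cast_zero] at h
  rcases I.card.eq_zero_or_pos with hp | hp
  · simp [hp]
  have hp' : (0 : ℝ) < I.card := by exact_mod_cast hp
  have ht' : (0 : ℝ) < t := by exact_mod_cast ht
  suffices (I.card : ℝ) ≤ t ^ 2 by exact_mod_cast this
  have key : 0 ≤ (t * (I.card : ℝ)) * (t ^ 2 - I.card) := by nlinarith
  have := nonneg_of_mul_nonneg_right key (by positivity)
  linarith

theorem SimpleGraph.exists_isClique_or_isIndepSet_of_two_pow_le_card (a b : ℕ) (S : Finset V)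
    (hS : 2 ^ (a + b) ≤ S.card) :
    (∃ C ⊆ S, G.IsClique (C : Set V) ∧ C.card = a) ∨
      ∃ I ⊆ S, G.IsIndepSet (I : Set V) ∧ I.card = b := by
  induction hn : a + b generalizing a b S with
  | zero =>
    left
    refine ⟨∅, by simp, by simp, ?_⟩
    simp; omega
  | succ n ih =>
    rcases a with _ | a
    · exact Or.inl ⟨∅, by simp, by simp, by simp⟩
    rcases b with _ | b
    · exact Or.inr ⟨∅, by simp, by simp [SimpleGraph.IsIndepSet], by simp⟩
    have hSpos : 0 < S.card := lt_of_lt_of_le (by positivity) hS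
    obtain ⟨x, hx⟩ := Finset.card_pos.1 hSpos
    have hsplit := Finset.card_filter_add_card_filter_not (s := S.erase x) (fun y => G.Adj x y)
    rw [Finset.card_erase_of_mem hx] at hsplit
    rw [hn, pow_succ] at hS
    rcases le_or_gt (2 ^ n) ((S.erase x).filter (fun y => G.Adj x y)).card with h | h
    · rcases ih a (b + 1) _ (by rwa [show a + (b + 1) = n by omega]) (by omega) with
        ⟨C, hC, hC', hC''⟩ | ⟨I, hI, hI', hI''⟩
      · left
        have hxC : x ∉ C := fun h => by simpa using hC h
        refine ⟨insert x C, ?_, ?_, by simp [hxC, hC'']⟩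
        · exact Finset.insert_subset hx ((hC.trans (Finset.filter_subset _ _)).trans
            (Finset.erase_subset _ _))
        · rw [Finset.coe_insert, SimpleGraph.isClique_insert]
          exact ⟨hC', fun y hy _ => (Finset.mem_filter.1 (hC hy)).2⟩
      · exact Or.inr ⟨I, (hI.trans (Finset.filter_subset _ _)).trans
            (Finset.erase_subset _ _), hI', hI''⟩
    · have h' : 2 ^ n ≤ ((S.erase x).filter (fun y => ¬ G.Adj x y)).card := by omega
      rcases ih (a + 1) b _ (by rwa [show a + 1 + b = n by omega]) (by omega) with
        ⟨C, hC, hC', hC''⟩ | ⟨I, hI, hI', hI''⟩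
      · exact Or.inl ⟨C, (hC.trans (Finset.filter_subset _ _)).trans
            (Finset.erase_subset _ _), hC', hC''⟩
      · right
        have hxI : x ∉ I := fun h => by simpa using hI h
        refine ⟨insert x I, ?_, ?_, by simp [hxI, hI'']⟩
        · exact Finset.insert_subset hx ((hI.trans (Finset.filter_subset _ _)).trans
            (Finset.erase_subset _ _))
        · have hadj : ∀ y ∈ I, ¬ G.Adj x y := fun y hy => (Finset.mem_filter.1 (hI hy)).2
          intro y hy z hz hyz
          simp only [Finset.coe_insert, Set.mem_insert_iff, Finset.mem_coe] at hy hz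
          rcases hy with rfl | hy <;> rcases hz with rfl | hz
          · exact absurd rfl hyz
          · exact hadj z hz
          · exact fun h => hadj y hy h.symm
          · exact hI' hy hz hyz

theorem ShiftedFormNonneg.exists_isClique_subset {t : ℕ} (ht : 0 < t)
    (hG : ShiftedFormNonneg G t) {x : V}
    {S : Finset V} (hS : ∀ y ∈ S, G.Adj x y) (n : ℕ) (hn : 2 ^ (n + (t ^ 2 + 1)) ≤ S.card) :
    ∃ C ⊆ S, G.IsClique (C : Set V) ∧ C.card = n := by
  rcases G.exists_isClique_or_isIndepSet_of_two_pow_le_card n (t ^ 2 + 1) S hn with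
    h | ⟨I, hI, hI', hI''⟩
  · exact h
  · have := hG.card_le_sq_of_isIndepSet ht (fun y hy => hS y (hI hy)) hI'
    omega

variable (G) in
/-- The vertices with more than `s` neighbours in `C`. -/
def attached (s : ℕ) (C : Finset V) : Finset V :=
  Finset.univ.filter fun y => s < (C.filter (G.Adj y)).card

variable {C : Finset V} {s : ℕ} {x y : V}

theorem mem_attached : y ∈ attached G s C ↔ s < (C.filter (G.Adj y)).card := by
  simp [attached]

theorem card_filter_adj_le_of_notMem_attached (h : y ∉ attached G s C) :
    (C.filter (G.Adj y)).card ≤ s := by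
  simpa [attached] using h

theorem subset_attached (hC : G.IsClique (C : Set V)) (hs : s + 1 < C.card) :
    C ⊆ attached G s C := by
  intro y hy
  rw [mem_attached]
  have : C.erase y ⊆ C.filter (G.Adj y) := by
    intro z hz
    rw [Finset.mem_erase] at hz
    exact Finset.mem_filter.2 ⟨hz.2, hC hy hz.2 (Ne.symm hz.1)⟩
  have := Finset.card_le_card this
  rw [Finset.card_erase_of_mem hy] at this
  omega

theorem ShiftedFormNonneg.card_filter_not_adj_le {m : ℕ} (hG : ShiftedFormNonneg G (m + 1))
    (hC : G.IsClique (C : Set V)) (hn : ((m + 1) * m + 1) ^ 2 + 1 < C.card)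
    (hy : y ∈ attached G ((m + 1) * m) C) :
    (C.filter (fun z => ¬ G.Adj y z)).card ≤ (m + 1) * m + 1 := by
  rw [mem_attached] at hy
  have h := hG.card_mul_card_le (y := y) (W := C.filter (G.Adj y))
    (U := (C.filter (fun z => ¬ G.Adj y z)).erase y) (by simp) (by simp) (by simp) (by
      intro w hw u hu
      simp only [Finset.mem_filter, Finset.mem_erase] at hw hu
      exact hC hw.1 hu.2.1 fun h => hu.2.2 (h ▸ hw.2))
  have h1 := Finset.card_filter_add_card_filter_not (s := C) (fun z => G.Adj y z)
  have h2 := Finset.pred_card_le_card_erase (s := C.filter (fun z => ¬ G.Adj y z)) (a := y)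
  set p := (C.filter (G.Adj y)).card
  set q := ((C.filter (fun z => ¬ G.Adj y z)).erase y).card
  generalize (m + 1) * m = s at *
  by_contra! hlt
  have hq : s + 1 ≤ q := by omega
  have hpq : (s + 1) ^ 2 < p + q := by omega
  nlinarith [mul_le_mul' hy hq, Nat.mul_le_mul hy hq,
    mul_nonneg (sub_nonneg.2 (Nat.cast_le (α := ℤ).2 hy)) (sub_nonneg.2 (Nat.cast_le (α := ℤ).2 hq))]

theorem card_le_card_filter_forall_adj_add {k : ℕ} {W : Finset V}
    (hW : ∀ w ∈ W, (C.filter (fun z => ¬ G.Adj w z)).card ≤ k) :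
    C.card ≤ (C.filter (fun u => ∀ w ∈ W, G.Adj w u)).card + W.card * k := by
  have hsub : C ⊆ C.filter (fun u => ∀ w ∈ W, G.Adj w u) ∪
      W.biUnion fun w => C.filter (fun z => ¬ G.Adj w z) := by
    intro u hu
    by_cases h : ∀ w ∈ W, G.Adj w u
    · exact Finset.mem_union_left _ (Finset.mem_filter.2 ⟨hu, h⟩)
    · push Not at h
      obtain ⟨w, hw, hwu⟩ := h
      exact Finset.mem_union_right _ (Finset.mem_biUnion.2 ⟨w, hw, by simp [hu, hwu]⟩)
  calc C.card ≤ _ := Finset.card_le_card hsub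
    _ ≤ _ := Finset.card_union_le _ _
    _ ≤ _ := by gcongr; exact Finset.card_biUnion_le_card_mul _ _ _ hW

theorem ShiftedFormNonneg.card_filter_attached_le {m : ℕ} (hG : ShiftedFormNonneg G (m + 1))
    (hC : G.IsClique (C : Set V)) (hn : 3 * ((m + 1) * m + 1) ^ 2 < C.card)
    (hy : y ∉ attached G ((m + 1) * m) C) :
    ((attached G ((m + 1) * m) C).filter (G.Adj y)).card ≤ (m + 1) * m := by
  by_contra! hlt
  obtain ⟨W, hW, hWc⟩ := Finset.exists_subset_card_eq (Nat.succ_le_of_lt hlt)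
  have hpow : 1 ≤ ((m + 1) * m + 1) ^ 2 := Nat.one_le_pow _ _ (Nat.succ_pos _)
  have hyC : y ∉ C := fun h => hy (subset_attached hC (by nlinarith) h)
  have h1 := card_le_card_filter_forall_adj_add (G := G) (C := C) (W := W)
    (fun w hw => hG.card_filter_not_adj_le hC (by linarith) (Finset.mem_filter.1 (hW hw)).1)
  have h2 := card_filter_adj_le_of_notMem_attached hy
  have h3 := hG.card_mul_card_le (y := y) (W := W)
    (U := (C.filter (fun u => ∀ w ∈ W, G.Adj w u)).filter (fun z => ¬ G.Adj y z))
    (fun w hw => (Finset.mem_filter.1 (hW hw)).2) (by simp) (by simp [hyC])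
    (fun w hw u hu => by
      simp only [Finset.mem_filter] at hu
      exact hu.1.2 w hw)
  have h4 := Finset.card_filter_add_card_filter_not (s := C.filter (fun u => ∀ w ∈ W, G.Adj w u))
    (fun z => G.Adj y z)
  have h5 : ((C.filter (fun u => ∀ w ∈ W, G.Adj w u)).filter (fun z => G.Adj y z)).card ≤
      (C.filter (G.Adj y)).card :=
    Finset.card_le_card (Finset.filter_subset_filter _ (Finset.filter_subset _ _))
  rw [hWc] at h1 h3
  generalize (m + 1) * m = s at *
  generalize ((C.filter (fun u => ∀ w ∈ W, G.Adj w u)).filter (fun z => ¬ G.Adj y z)).card = q at *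
  simp only [Nat.succ_eq_add_one] at *
  have h6 : q ≤ s * (s + 1) := by nlinarith
  nlinarith

theorem ShiftedFormNonneg.card_filter_attached_not_adj_le {m : ℕ} (hm : 0 < m)
    (hG : ShiftedFormNonneg G (m + 1)) (hC : G.IsClique (C : Set V)) (hCx : ∀ z ∈ C, G.Adj x z)
    (hn : ((m + 1) * m + 1) ^ 2 + 1 < C.card)
    (hn' : (m ^ 2 + 1) * ((m + 1) * m + 1) + (m + (m ^ 2 + 1)) ^ 2 < C.card) :
    ((attached G ((m + 1) * m) C).filter (fun y => y ≠ x ∧ ¬ G.Adj x y)).card ≤ m ^ 2 := by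
  by_contra! hlt
  obtain ⟨T, hT, hTc⟩ := Finset.exists_subset_card_eq (Nat.succ_le_of_lt hlt)
  have hT' : ∀ y ∈ T, y ∈ attached G ((m + 1) * m) C ∧ y ≠ x ∧ ¬ G.Adj x y :=
    fun y hy => Finset.mem_filter.1 (hT hy)
  have h1 := card_le_card_filter_forall_adj_add (G := G) (C := C) (W := T)
    (fun w hw => hG.card_filter_not_adj_le hC hn (hT' w hw).1)
  set U := C.filter (fun u => ∀ w ∈ T, G.Adj w u)
  have hUC : ∀ u ∈ U, u ∈ C := fun u hu => (Finset.mem_filter.1 hu).1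
  have hTU : ∀ w ∈ T, ∀ u ∈ U, G.Adj w u := fun w hw u hu => (Finset.mem_filter.1 hu).2 w hw
  have d1 : Disjoint {x} T := by
    rw [Finset.disjoint_singleton_left]
    exact fun h => (hT' x h).2.1 rfl
  have d2 : Disjoint {x} U := by
    rw [Finset.disjoint_singleton_left]
    exact fun h => G.irrefl (hCx x (hUC x h))
  have d3 : Disjoint T U := by
    rw [Finset.disjoint_left]
    exact fun z hz hz' => G.irrefl (hTU z hz z hz')
  have hq : (m + (m ^ 2 + 1)) ^ 2 < U.card := by
    rw [hTc] at h1
    simp only [Nat.succ_eq_add_one] at h1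
    omega
  have h := hG.three_sets d1 d2 d3 (m * U.card) U.card (-(m + T.card))
  have eT := edgeCount_self_le (G := G) (S := T)
  have eU := edgeCount_self_le (G := G) (S := U)
  have e1 : edgeCount G {x} T = 0 :=
    edgeCount_eq_zero (by simpa using fun y hy => (hT' y hy).2.2)
  have e2 : edgeCount G {x} U = U.card := by
    rw [edgeCount_eq_card_mul_card (by simpa using fun y hy => hCx y (hUC y hy))]; simp
  rw [edgeCount_singleton_self, e1, e2, edgeCount_eq_card_mul_card hTU] at h
  simp only [Finset.card_singleton, Nat.cast_one] at h
  have hq' : ((m : ℝ) + (m ^ 2 + 1)) ^ 2 < U.card := by exact_mod_cast hq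
  have hTc' : (T.card : ℝ) = m ^ 2 + 1 := by exact_mod_cast hTc
  rw [hTc'] at h eT
  set q : ℝ := (U.card : ℝ)
  have hm' : (1 : ℝ) ≤ m := by exact_mod_cast hm
  have hq0 : 0 < q := lt_of_le_of_lt (by positivity) hq'
  have eT' := mul_le_mul_of_nonneg_left eT (sq_nonneg q)
  have eU' := mul_le_mul_of_nonneg_left eU (sq_nonneg ((m : ℝ) + (m ^ 2 + 1)))
  have key : 0 ≤ (m * q) * ((m + (m ^ 2 + 1)) ^ 2 - q) := by
    nlinarith
  have := nonneg_of_mul_nonneg_right key (by positivity)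
  linarith

end CliqueExtensions

section CliqueFamilies

variable {V : Type*} [Fintype V] [DecidableEq V] {G : SimpleGraph V} [DecidableRel G.Adj]

variable (G) in
/-- A family of disjoint `n`-cliques in the neighbourhood of `x` with few edges between any two
of them. -/
structure IsSparseCliqueFamily (s n : ℕ) (x : V) (F : Finset (Finset V)) : Prop where
  isClique : ∀ C ∈ F, G.IsClique (C : Set V)
  card_eq : ∀ C ∈ F, C.card = n
  adj : ∀ C ∈ F, ∀ z ∈ C, G.Adj x z
  disjoint : Set.PairwiseDisjoint (F : Set (Finset V)) id
  edgeCount_le : ∀ C ∈ F, ∀ D ∈ F, C ≠ D → edgeCount G C D ≤ n * s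

variable (G) in
/-- The neighbours of `x` with at most `s` neighbours in each member of `F`. -/
def uncovered (s : ℕ) (F : Finset (Finset V)) (x : V) : Finset V :=
  Finset.univ.filter fun w => G.Adj x w ∧ ∀ C ∈ F, w ∉ attached G s C

theorem mem_uncovered {s : ℕ} {F : Finset (Finset V)} {x w : V} :
    w ∈ uncovered G s F x ↔ G.Adj x w ∧ ∀ C ∈ F, w ∉ attached G s C := by
  simp [uncovered]

theorem IsSparseCliqueFamily.edgeCount_biUnion_le {s n : ℕ} {x : V} {F : Finset (Finset V)}
    (hF : IsSparseCliqueFamily G s n x F) :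
    edgeCount G (F.biUnion id) (F.biUnion id) ≤ F.card * (n ^ 2 + F.card * (n * s)) := by
  rw [edgeCount_biUnion_left hF.disjoint, ← nsmul_eq_mul]
  refine Finset.sum_le_card_nsmul _ _ _ fun C hC => ?_
  rw [edgeCount_biUnion_right hF.disjoint]
  calc ∑ D ∈ F, edgeCount G (id C) (id D)
      ≤ ∑ D ∈ F, ((if C = D then (n : ℝ) ^ 2 else 0) + n * s) := by
        refine Finset.sum_le_sum fun D hD => ?_
        split_ifs with h
        · subst h
          have := edgeCount_le_card_mul_card (G := G) (S := C) (T := C)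
          rw [hF.card_eq C hC] at this
          have : (0 : ℝ) ≤ n * s := by positivity
          simp only [id]
          nlinarith
        · simpa using hF.edgeCount_le C hC D hD h
    _ = _ := by
        rw [Finset.sum_add_distrib, Finset.sum_ite_eq, if_pos hC]
        simp

theorem ShiftedFormNonneg.le_of_mem_uncovered {m n : ℕ} (hG : ShiftedFormNonneg G (m + 1))
    {x w : V} {F : Finset (Finset V)} (hF : IsSparseCliqueFamily G ((m + 1) * m) n x F)
    (hcard : F.card = m + 1) (hw : w ∈ uncovered G ((m + 1) * m) F x)
    (hn : (m + 1) * m + 1 < n) :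
    n ≤ (m + 1) ^ 3 * ((m + 1) * m) + 2 * (m + 1) * ((m + 1) * m) + (m + 1) ^ 3 := by
  rw [mem_uncovered] at hw
  obtain ⟨hxw, hwF⟩ := hw
  have hUcard : (F.biUnion id).card = (m + 1) * n := by
    rw [Finset.card_biUnion hF.disjoint]
    simp only [id]
    rw [Finset.sum_const_nat fun C hC => hF.card_eq C hC, hcard]
  have hxU : ∀ z ∈ F.biUnion id, G.Adj x z := by
    intro z hz
    obtain ⟨C, hC, hz⟩ := Finset.mem_biUnion.1 hz
    exact hF.adj C hC z hz
  have d1 : Disjoint ({x} : Finset V) {w} := by simpa using hxw.ne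
  have d2 : Disjoint {x} (F.biUnion id) := by
    rw [Finset.disjoint_singleton_left]
    exact fun h => G.irrefl (hxU x h)
  have d3 : Disjoint {w} (F.biUnion id) := by
    rw [Finset.disjoint_singleton_left]
    intro h
    obtain ⟨C, hC, hz⟩ := Finset.mem_biUnion.1 h
    exact hwF C hC (subset_attached (hF.isClique C hC) (by rwa [hF.card_eq C hC]) hz)
  have h := hG.three_sets d1 d2 d3 (-((m + 1) * n)) n (m + 1)
  have e1 : edgeCount G {x} {w} = 1 := by
    rw [edgeCount_eq_card_mul_card (by simpa using hxw)]; simp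
  have e2 : edgeCount G {x} (F.biUnion id) = (m + 1) * n := by
    rw [edgeCount_eq_card_mul_card (by simpa using hxU), hUcard]; simp
  have e3 : edgeCount G {w} (F.biUnion id) ≤ (m + 1) * ((m + 1) * m) := by
    rw [edgeCount_biUnion_right hF.disjoint]
    calc _ ≤ F.card • (((m + 1) * m : ℕ) : ℝ) := by
          refine Finset.sum_le_card_nsmul _ _ _ fun C hC => ?_
          rw [edgeCount_eq_sum_card, Finset.sum_singleton]
          exact_mod_cast card_filter_adj_le_of_notMem_attached (hwF C hC)
      _ = _ := by rw [hcard]; simp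
  have e4 := hF.edgeCount_biUnion_le
  rw [edgeCount_singleton_self, edgeCount_singleton_self, e1, e2, hUcard] at h
  simp only [Finset.card_singleton, Nat.cast_one] at h
  rw [hcard] at e4
  push_cast at h e4
  have hn' : (0 : ℝ) < n := by exact_mod_cast (by omega : 0 < n)
  have e3' := mul_le_mul_of_nonneg_left e3 (by positivity : 0 ≤ 2 * ((n : ℝ) * (m + 1)))
  have e4' := mul_le_mul_of_nonneg_left e4 (sq_nonneg ((m : ℝ) + 1))
  suffices (n : ℝ) ≤ (m + 1) ^ 3 * ((m + 1) * m) + 2 * (m + 1) * ((m + 1) * m) + (m + 1) ^ 3 by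
    exact_mod_cast this
  have key : 0 ≤ ((m + 1) * (n : ℝ)) *
      ((m + 1) ^ 3 * ((m + 1) * m) + 2 * (m + 1) * ((m + 1) * m) + (m + 1) ^ 3 - n) := by
    nlinarith
  have := nonneg_of_mul_nonneg_right key (by positivity)
  linarith

theorem IsSparseCliqueFamily.insert {s n : ℕ} {x : V} {F : Finset (Finset V)} {C : Finset V}
    (hF : IsSparseCliqueFamily G s n x F) (hn : s + 1 < n) (hC : C ⊆ uncovered G s F x)
    (hCc : G.IsClique (C : Set V)) (hCn : C.card = n) :
    IsSparseCliqueFamily G s n x (insert C F) ∧ C ∉ F := by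
  have hd : ∀ D ∈ F, Disjoint D C := by
    intro D hD
    rw [Finset.disjoint_left]
    intro z hzD hzC
    exact (mem_uncovered.1 (hC hzC)).2 D hD
      (subset_attached (hF.isClique D hD) (by rwa [hF.card_eq D hD]) hzD)
  have hcross : ∀ D ∈ F, edgeCount G C D ≤ n * s := by
    intro D hD
    rw [← hCn]
    exact edgeCount_le_mul fun z hz =>
      card_filter_adj_le_of_notMem_attached ((mem_uncovered.1 (hC hz)).2 D hD)
  refine ⟨⟨?_, ?_, ?_, ?_, ?_⟩, ?_⟩
  · simpa [hCc] using hF.isClique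
  · simpa [hCn] using hF.card_eq
  · intro D hD z hz
    rcases Finset.mem_insert.1 hD with rfl | hD
    · exact (mem_uncovered.1 (hC hz)).1
    · exact hF.adj D hD z hz
  · rw [Finset.coe_insert]
    exact hF.disjoint.insert fun D hD _ => (hd D hD).symm
  · intro D hD E hE hDE
    rcases Finset.mem_insert.1 hD with hD' | hD' <;>
      rcases Finset.mem_insert.1 hE with hE' | hE'
    · exact absurd (hD'.trans hE'.symm) hDE
    · rw [hD']; exact hcross E hE'
    · rw [edgeCount_comm, hE']; exact hcross D hD'
    · exact hF.edgeCount_le D hD' E hE' hDE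
  · intro h
    have := hd C h
    rw [disjoint_self, Finset.bot_eq_empty] at this
    subst this
    simp at hCn
    omega

theorem ShiftedFormNonneg.exists_sparseCliqueFamily {m n : ℕ} (hG : ShiftedFormNonneg G (m + 1))
    (hn : (m + 1) * m + 1 < n)
    (hn' : (m + 1) ^ 3 * ((m + 1) * m) + 2 * (m + 1) * ((m + 1) * m) + (m + 1) ^ 3 < n) (x : V) :
    ∃ F, IsSparseCliqueFamily G ((m + 1) * m) n x F ∧ F.card ≤ m + 1 ∧
      (uncovered G ((m + 1) * m) F x).card < 2 ^ (n + ((m + 1) ^ 2 + 1)) ∧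
      ((uncovered G ((m + 1) * m) F x).Nonempty → F.card ≤ m) := by
  by_contra! hcon
  have hgrow : ∀ d ≤ m + 1, ∃ F, IsSparseCliqueFamily G ((m + 1) * m) n x F ∧ F.card = d := by
    intro d
    induction d with
    | zero => exact fun _ => ⟨∅, ⟨by simp, by simp, by simp, by simp, by simp⟩, by simp⟩
    | succ d ih =>
      intro hd
      obtain ⟨F, hF, hFc⟩ := ih (by omega)
      have hbig : 2 ^ (n + ((m + 1) ^ 2 + 1)) ≤ (uncovered G ((m + 1) * m) F x).card := by
        by_contra! hlt
        have := (hcon F hF (by omega) hlt).2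
        omega
      obtain ⟨C, hC, hCc, hCn⟩ := ShiftedFormNonneg.exists_isClique_subset (t := m + 1)
        (Nat.succ_pos m) (by push_cast; exact hG) (fun y hy => (mem_uncovered.1 hy).1) n hbig
      obtain ⟨h1, h2⟩ := hF.insert hn hC hCc hCn
      exact ⟨_, h1, by rw [Finset.card_insert_of_notMem h2, hFc]⟩
  obtain ⟨F, hF, hFc⟩ := hgrow (m + 1) le_rfl
  have hempty : uncovered G ((m + 1) * m) F x = ∅ := by
    by_contra hne
    obtain ⟨w, hw⟩ := Finset.nonempty_iff_ne_empty.2 hne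
    have := hG.le_of_mem_uncovered hF hFc hw hn
    omega
  have := (hcon F hF hFc.le (by rw [hempty]; simp)).1
  rw [hempty] at this
  simp at this

end CliqueFamilies

section SesquiRegular

variable {V : Type*} [Fintype V] [DecidableEq V] {G : SimpleGraph V} [DecidableRel G.Adj]

variable (G) in
/-- Any two distinct nonadjacent vertices with a common neighbour have exactly `c` of them. -/
def HasConstCommonNeighbors (c : ℕ) : Prop :=
  ∀ ⦃x y z : V⦄, x ≠ y → ¬ G.Adj x y → G.Adj x z → G.Adj y z →
    (Finset.univ.filter fun w => G.Adj x w ∧ G.Adj y w).card = c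

variable {m n c : ℕ} {F : Finset (Finset V)} {C : Finset V} {x y z : V}

theorem ShiftedFormNonneg.card_biUnion_attached_le (hG : ShiftedFormNonneg G (m + 1))
    (hF : IsSparseCliqueFamily G ((m + 1) * m) n x F) (hn : 3 * ((m + 1) * m + 1) ^ 2 < n)
    (hy : ∀ D ∈ F, y ∉ attached G ((m + 1) * m) D) :
    (F.biUnion fun D => (attached G ((m + 1) * m) D).filter (G.Adj y)).card ≤
      F.card * ((m + 1) * m) :=
  Finset.card_biUnion_le_card_mul _ _ _ fun D hD =>
    hG.card_filter_attached_le (hF.isClique D hD) (by rwa [hF.card_eq D hD]) (hy D hD)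

theorem ShiftedFormNonneg.commonNeighbors_le_of_mem_uncovered (hG : ShiftedFormNonneg G (m + 1))
    (hc : HasConstCommonNeighbors G c) (hn : 3 * ((m + 1) * m + 1) ^ 2 < n)
    (hF : IsSparseCliqueFamily G ((m + 1) * m) n x F) (hFc : F.card ≤ m)
    (hz : z ∈ uncovered G ((m + 1) * m) F x) (hC : G.IsClique (C : Set V))
    (hCz : ∀ u ∈ C, G.Adj z u) (hCn : 3 * ((m + 1) * m + 1) ^ 2 < C.card)
    (hCR : ((uncovered G ((m + 1) * m) F x).card + m + 1) * ((m + 1) * m + 1) < C.card) :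
    c ≤ (m + 1) ^ 2 * m := by
  have hz' := mem_uncovered.1 hz
  have hpow : 1 ≤ ((m + 1) * m + 1) ^ 2 := Nat.one_le_pow _ _ (Nat.succ_pos _)
  have hB := hG.card_biUnion_attached_le hF hn hz'.2
  have hB' : F.card * ((m + 1) * m) ≤ m * ((m + 1) * m) := Nat.mul_le_mul_right _ hFc
  have hcov : ∀ u, G.Adj x u → u ∈ uncovered G ((m + 1) * m) F x ∨
      ∃ D ∈ F, u ∈ attached G ((m + 1) * m) D := by
    intro u hu
    by_contra! h
    exact h.1 (mem_uncovered.2 ⟨hu, h.2⟩)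
  have hxC : x ∉ attached G ((m + 1) * m) C := by
    intro hx
    have h1 := hG.card_filter_not_adj_le hC (by linarith) hx
    have h2 := Finset.card_filter_add_card_filter_not (s := C) (fun z => G.Adj x z)
    have h3 : C.filter (fun z => G.Adj x z) ⊆ uncovered G ((m + 1) * m) F x ∪
        F.biUnion fun D => (attached G ((m + 1) * m) D).filter (G.Adj z) := by
      intro u hu
      rw [Finset.mem_filter] at hu
      rcases hcov u hu.2 with h | ⟨D, hD, h⟩
      · exact Finset.mem_union_left _ h
      · exact Finset.mem_union_right _ (Finset.mem_biUnion.2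
          ⟨D, hD, Finset.mem_filter.2 ⟨h, hCz u hu.1⟩⟩)
    have h4 := (Finset.card_le_card h3).trans (Finset.card_union_le _ _)
    generalize (m + 1) * m = s at *
    nlinarith
  obtain ⟨y, hyC, hy⟩ : ∃ y ∈ C, y ∉ C.filter (G.Adj x) ∪
      ((F.biUnion fun D => (attached G ((m + 1) * m) D).filter (G.Adj z)) ∪
      ((uncovered G ((m + 1) * m) F x).filter fun w => w ∉ attached G ((m + 1) * m) C).biUnion
        fun w => C.filter (G.Adj w)) := by
    apply Finset.exists_mem_notMem_of_card_lt_card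
    have h1 := card_filter_adj_le_of_notMem_attached hxC
    have h2 : (((uncovered G ((m + 1) * m) F x).filter
        fun w => w ∉ attached G ((m + 1) * m) C).biUnion fun w => C.filter (G.Adj w)).card ≤
        (uncovered G ((m + 1) * m) F x).card * ((m + 1) * m) := by
      refine (Finset.card_biUnion_le_card_mul _ _ ((m + 1) * m) fun w hw =>
        card_filter_adj_le_of_notMem_attached (Finset.mem_filter.1 hw).2).trans ?_
      exact Nat.mul_le_mul_right _ (Finset.card_filter_le _ _)
    refine (Finset.card_union_le _ _).trans_lt ?_
    refine (Nat.add_le_add_left (Finset.card_union_le _ _) _).trans_lt ?_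
    generalize (m + 1) * m = s at *
    nlinarith
  simp only [Finset.mem_union, Finset.mem_biUnion, Finset.mem_filter, not_or, not_exists,
    not_and] at hy
  obtain ⟨hxy, hyF, hyL⟩ := hy
  have hyF' : ∀ D ∈ F, y ∉ attached G ((m + 1) * m) D :=
    fun D hD h => hyF D hD h (hCz y hyC)
  have hne : x ≠ y := by
    rintro rfl
    exact hxC (subset_attached hC (by nlinarith) hyC)
  rw [← hc hne (hxy hyC) hz'.1 (hCz y hyC).symm]
  have hsub : (Finset.univ.filter fun w => G.Adj x w ∧ G.Adj y w) ⊆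
      (attached G ((m + 1) * m) C).filter (G.Adj x) ∪
      F.biUnion fun D => (attached G ((m + 1) * m) D).filter (G.Adj y) := by
    intro w hw
    simp only [Finset.mem_filter, Finset.mem_univ, true_and] at hw
    by_cases hwC : w ∈ attached G ((m + 1) * m) C
    · exact Finset.mem_union_left _ (Finset.mem_filter.2 ⟨hwC, hw.1⟩)
    rcases hcov w hw.1 with h | ⟨D, hD, h⟩
    · exact absurd hw.2.symm (hyL w ⟨h, hwC⟩ hyC)
    · exact Finset.mem_union_right _ (Finset.mem_biUnion.2
          ⟨D, hD, Finset.mem_filter.2 ⟨h, hw.2⟩⟩)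
  have h1 := (Finset.card_le_card hsub).trans (Finset.card_union_le _ _)
  have h2 := hG.card_filter_attached_le hC hCn hxC
  have h3 := hG.card_biUnion_attached_le hF hn hyF'
  nlinarith

theorem ShiftedFormNonneg.card_filter_not_adj_le_of_uncovered_eq_empty (hm : 0 < m)
    (hG : ShiftedFormNonneg G (m + 1)) (hconn : G.Connected)
    (hc : HasConstCommonNeighbors G c) (hn : 3 * ((m + 1) * m + 1) ^ 2 < n)
    (hn' : (m ^ 2 + 1) * ((m + 1) * m + 1) + (m + (m ^ 2 + 1)) ^ 2 < n)
    (hF : IsSparseCliqueFamily G ((m + 1) * m) n x F) (hFc : F.card ≤ m + 1)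
    (hunc : uncovered G ((m + 1) * m) F x = ∅) (hlt : (m + 1) ^ 2 * m < c) :
    (Finset.univ.filter fun y => y ≠ x ∧ ¬ G.Adj x y).card ≤ (m + 1) * m ^ 2 := by
  have hpow : 1 ≤ ((m + 1) * m + 1) ^ 2 := Nat.one_le_pow _ _ (Nat.succ_pos _)
  have hcov : ∀ u, G.Adj x u → ∃ D ∈ F, u ∈ attached G ((m + 1) * m) D := by
    intro u hu
    by_contra! h
    have := mem_uncovered.2 ⟨hu, h⟩
    simp [hunc] at this
  have hsmall : ∀ y, (∀ D ∈ F, y ∉ attached G ((m + 1) * m) D) → ∀ S : Finset V,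
      (∀ w ∈ S, G.Adj y w ∧ ∃ D ∈ F, w ∈ attached G ((m + 1) * m) D) → S.card < c := by
    intro y hy S hS
    have h1 : S ⊆ F.biUnion fun D => (attached G ((m + 1) * m) D).filter (G.Adj y) := by
      intro w hw
      obtain ⟨hyw, D, hD, hwD⟩ := hS w hw
      exact Finset.mem_biUnion.2 ⟨D, hD, Finset.mem_filter.2 ⟨hwD, hyw⟩⟩
    have h2 := Finset.card_le_card h1
    have h3 := hG.card_biUnion_attached_le hF hn hy
    nlinarith
  have hdist2 : ∀ y, x ≠ y → ¬ G.Adj x y → (∃ z, G.Adj x z ∧ G.Adj y z) →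
      ∃ D ∈ F, y ∈ attached G ((m + 1) * m) D := by
    rintro y hxy hadj ⟨z, hxz, hyz⟩
    by_contra! h
    refine (hsmall y h _ fun w hw => ?_).ne (hc hxy hadj hxz hyz)
    simp only [Finset.mem_filter, Finset.mem_univ, true_and] at hw
    exact ⟨hw.2, hcov w hw.1⟩
  have hdiam : ∀ y, x = y ∨ G.Adj x y ∨ ∃ z, G.Adj x z ∧ G.Adj y z := by
    intro y
    obtain ⟨p⟩ := hconn.preconnected y x
    induction p with
    | nil => exact Or.inl rfl
    | @cons w y _ hwy p ih =>
      have ih := ih hF hunc hcov hdist2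
      by_contra! hw
      obtain ⟨hw1, hw2, hw3⟩ := hw
      rcases ih with rfl | h | ⟨y', hxy', hyy'⟩
      · exact hw2 hwy.symm
      · exact hw3 y h hwy
      have hwF : ∀ D ∈ F, w ∉ attached G ((m + 1) * m) D := by
        intro D hD h
        rw [mem_attached] at h
        obtain ⟨u, hu⟩ := Finset.card_pos.1 (Nat.zero_lt_of_lt h)
        rw [Finset.mem_filter] at hu
        exact hw3 u (hF.adj D hD u hu.1) hu.2
      have hne : w ≠ y' := by
        rintro rfl
        exact hw2 hxy'
      refine (hsmall w hwF _ fun u hu => ?_).ne (hc hne (hw3 y' hxy') hwy hyy'.symm)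
      simp only [Finset.mem_filter, Finset.mem_univ, true_and] at hu
      refine ⟨hu.1, hdist2 u ?_ (fun h => hw3 u h hu.1) ⟨y', hxy', hu.2.symm⟩⟩
      rintro rfl
      exact hw2 hu.1.symm
  have hsub : (Finset.univ.filter fun y => y ≠ x ∧ ¬ G.Adj x y) ⊆
      F.biUnion fun D =>
        (attached G ((m + 1) * m) D).filter (fun y => y ≠ x ∧ ¬ G.Adj x y) := by
    intro y hy
    have hy' := (Finset.mem_filter.1 hy).2
    obtain ⟨D, hD, h⟩ := hdist2 y hy'.1.symm hy'.2
      (((hdiam y).resolve_left hy'.1.symm).resolve_left hy'.2)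
    exact Finset.mem_biUnion.2 ⟨D, hD, Finset.mem_filter.2 ⟨h, hy'⟩⟩
  calc _ ≤ _ := Finset.card_le_card hsub
    _ ≤ F.card * m ^ 2 := Finset.card_biUnion_le_card_mul _ _ _ fun D hD =>
        hG.card_filter_attached_not_adj_le hm (hF.isClique D hD) (hF.adj D hD)
          (by rw [hF.card_eq D hD]; linarith) (by rwa [hF.card_eq D hD])
    _ ≤ _ := Nat.mul_le_mul_right _ hFc

theorem exists_forall_commonNeighbors_le_or_card_filter_not_adj_le (m : ℕ) (hm : 0 < m) :
    ∃ K : ℕ, ∀ (V : Type) [Fintype V] [DecidableEq V] (G : SimpleGraph V) [DecidableRel G.Adj]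
      (k c : ℕ), G.Connected → ShiftedFormNonneg G (m + 1) → HasConstCommonNeighbors G c →
      (∀ x, (Finset.univ.filter (G.Adj x)).card = k) → K ≤ k →
      c ≤ (m + 1) ^ 2 * m ∨
        ∀ x, (Finset.univ.filter fun y => y ≠ x ∧ ¬ G.Adj x y).card ≤ (m + 1) * m ^ 2 := by
  obtain ⟨n, hn⟩ : ∃ n, n = 3 * ((m + 1) * m + 1) ^ 2
      + ((m ^ 2 + 1) * ((m + 1) * m + 1) + (m + (m ^ 2 + 1)) ^ 2)
      + ((m + 1) ^ 3 * ((m + 1) * m) + 2 * (m + 1) * ((m + 1) * m) + (m + 1) ^ 3) + 1 := ⟨_, rfl⟩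
  obtain ⟨N, hN⟩ : ∃ N, N = n +
      (2 ^ (n + ((m + 1) ^ 2 + 1)) + m + 1) * ((m + 1) * m + 1) := ⟨_, rfl⟩
  refine ⟨2 ^ (N + ((m + 1) ^ 2 + 1)), fun V _ _ G _ k c hconn hG hc hk hkK => ?_⟩
  rw [or_iff_not_imp_left, not_le]
  intro hlt x
  have hpow : (m + 1) * m + 1 ≤ ((m + 1) * m + 1) ^ 2 := Nat.le_self_pow two_ne_zero _
  have hn1 : 3 * ((m + 1) * m + 1) ^ 2 < n := by omega
  obtain ⟨F, hF, hFc, hFR, hFne⟩ := hG.exists_sparseCliqueFamily (n := n) (by omega) (by omega) x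
  refine hG.card_filter_not_adj_le_of_uncovered_eq_empty hm hconn hc hn1 (by omega) hF hFc ?_ hlt
  by_contra hne
  have hne := Finset.nonempty_iff_ne_empty.2 hne
  have hFm := hFne hne
  obtain ⟨z, hz⟩ := hne
  obtain ⟨C, hC, hCc, hCn⟩ := ShiftedFormNonneg.exists_isClique_subset (t := m + 1)
    (Nat.succ_pos m) (by push_cast; exact hG) (x := z) (S := Finset.univ.filter (G.Adj z))
    (by simp) N (by rwa [hk z])
  refine hlt.not_ge (hG.commonNeighbors_le_of_mem_uncovered hc hn1 hF hFm hz hCc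
    (fun u hu => (Finset.mem_filter.1 (hC hu)).2) (by omega) ?_)
  have : ((uncovered G ((m + 1) * m) F x).card + m + 1) * ((m + 1) * m + 1) ≤
      (2 ^ (n + ((m + 1) ^ 2 + 1)) + m + 1) * ((m + 1) * m + 1) := by gcongr
  omega

end SesquiRegular

section ComplementDegree

theorem exists_radial_profile {D θ : ℝ} (hD : θ ^ 2 < 4 * D) :
    ∃ (r : ℕ) (φ : ℕ → ℝ), φ 0 = 1 ∧ φ 1 = 1 ∧ Antitone φ ∧ (∀ i, 0 ≤ φ i) ∧
      (∀ i, r ≤ i → φ i = 0) ∧ ∀ i, θ * φ (i + 1) ≤ φ i + D * φ (i + 2) := by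
  have hD0 : 0 < D := by nlinarith
  let p : ℕ → ℝ × ℝ := fun n => Nat.rec (1, 1) (fun _ q => (q.2, (θ * q.2 - q.1) / D)) n
  let a : ℕ → ℝ := fun n => (p n).1
  have ha0 : a 0 = 1 := rfl
  have ha1 : a 1 = 1 := rfl
  have harec : ∀ n, D * a (n + 2) = θ * a (n + 1) - a n := by
    intro n
    have : a (n + 2) = (θ * a (n + 1) - a n) / D := rfl
    rw [this]
    field_simp
  set δ : ℝ := (1 - θ ^ 2 / (4 * D)) / D with hδ
  have hδ0 : 0 < δ := by
    have : θ ^ 2 / (4 * D) < 1 := by rw [div_lt_one (by positivity)]; exact hD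
    exact div_pos (by linarith) hD0
  have hstep : ∀ n, a (n + 2) * a n ≤ a (n + 1) ^ 2 - δ * a n ^ 2 := by
    intro n
    have h1 : D * (δ * a n ^ 2) = (1 - θ ^ 2 / (4 * D)) * a n ^ 2 := by
      rw [hδ]; field_simp
    have h2 : D * (a (n + 1) - θ / (2 * D) * a n) ^ 2 =
        D * a (n + 1) ^ 2 - θ * a (n + 1) * a n + θ ^ 2 / (4 * D) * a n ^ 2 := by
      field_simp
      ring
    have h3 : 0 ≤ D * (a (n + 1) - θ / (2 * D) * a n) ^ 2 := by positivity
    have h4 : D * a (n + 2) * a n = (θ * a (n + 1) - a n) * a n := by rw [harec n]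
    have : D * (a (n + 2) * a n) ≤ D * (a (n + 1) ^ 2 - δ * a n ^ 2) := by
      nlinarith
    exact le_of_mul_le_mul_left this hD0
  have hratio : ∀ n, (∀ i ≤ n, 0 < a i) → a (n + 1) ≤ (1 - n * δ) * a n := by
    intro n
    induction n with
    | zero => intro _; simp [ha0, ha1]
    | succ n ih =>
      intro hpos
      have hn := hpos n (by omega)
      have hn1 := hpos (n + 1) le_rfl
      have ih := ih fun i hi => hpos i (by omega)
      have hs := hstep n
      have hle : a (n + 1) ≤ a n := by
        refine ih.trans ?_
        have : 0 ≤ (n : ℝ) * δ := by positivity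
        nlinarith
      have : a (n + 2) * a n ≤ ((1 - (n + 1) * δ) * a (n + 1)) * a n := by
        have e1 : a (n + 1) * a (n + 1) ≤ a (n + 1) * ((1 - n * δ) * a n) :=
          mul_le_mul_of_nonneg_left ih hn1.le
        have e2 : δ * (a (n + 1) * a n) ≤ δ * a n ^ 2 :=
          mul_le_mul_of_nonneg_left (by nlinarith) hδ0.le
        nlinarith
      have := le_of_mul_le_mul_right this hn
      push_cast
      exact this
  have hex : ∃ n, a n ≤ 0 := by
    by_contra! hpos
    obtain ⟨n, hn⟩ := exists_nat_gt (1 / δ)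
    have h1 := hratio n fun i _ => hpos i
    have h2 : 1 < n * δ := by rwa [div_lt_iff₀ hδ0] at hn
    nlinarith [hpos n, hpos (n + 1)]
  obtain ⟨r, hr, hmin⟩ : ∃ r, a r ≤ 0 ∧ ∀ i < r, 0 < a i := by
    classical
    exact ⟨Nat.find hex, Nat.find_spec hex, fun i hi => not_le.1 (Nat.find_min hex hi)⟩
  have hr2 : 2 ≤ r := by
    by_contra! h
    interval_cases r <;> linarith
  have hanti : ∀ i, i + 1 < r → a (i + 1) ≤ a i := by
    intro i hi
    refine (hratio i fun j hj => hmin j (by omega)).trans ?_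
    have := hmin i (by omega)
    have : 0 ≤ (i : ℝ) * δ := by positivity
    nlinarith
  have hnonneg : ∀ i, 0 ≤ if i < r then a i else 0 := by
    intro i
    split_ifs with h
    · exact (hmin i h).le
    · exact le_rfl
  refine ⟨r, fun i => if i < r then a i else 0, by simp [ha0]; omega, by simp [ha1]; omega,
    antitone_nat_of_succ_le fun i => ?_, hnonneg, fun i hi => by simp; omega, fun i => ?_⟩
  · by_cases h : i + 1 < r
    · simpa [h, (by omega : i < r)] using hanti i h
    · simpa [h] using hnonneg i
  · by_cases h : i + 1 < r
    · have h2 : a (i + 2) ≤ if i + 2 < r then a (i + 2) else 0 := by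
        split_ifs with h'
        · exact le_rfl
        · rw [show i + 2 = r by omega]; exact hr
      simp only [h, (by omega : i < r), if_true]
      have := mul_le_mul_of_nonneg_left h2 hD0.le
      linarith [harec i]
    · have := mul_nonneg hD0.le (hnonneg (i + 2))
      have := hnonneg i
      simp only [h, if_false, mul_zero]
      linarith

variable {V : Type*} [Fintype V] [DecidableEq V]

theorem SimpleGraph.exists_finset_walk_length_le (H : SimpleGraph V) [DecidableRel H.Adj] {l : ℕ}
    (hl : ∀ x, (Finset.univ.filter (H.Adj x)).card = l) (u : V) (r : ℕ) :
    ∃ T : Finset V, T.card ≤ (l + 1) ^ r ∧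
      ∀ (x : V) (p : H.Walk x u), p.length ≤ r → x ∈ T := by
  induction r with
  | zero =>
    refine ⟨{u}, by simp, fun x p hp => ?_⟩
    simpa using SimpleGraph.Walk.eq_of_length_eq_zero (Nat.le_zero.1 hp)
  | succ r ih =>
    obtain ⟨T, hT, hTw⟩ := ih
    refine ⟨T.biUnion fun y => insert y (Finset.univ.filter (H.Adj y)), ?_, fun x p hp => ?_⟩
    · refine (Finset.card_biUnion_le_card_mul _ _ (l + 1) fun y _ => ?_).trans ?_
      · exact (Finset.card_insert_le _ _).trans (by rw [hl])
      · rw [pow_succ]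
        exact Nat.mul_le_mul_right _ hT
    · rw [Finset.mem_biUnion]
      cases p with
      | nil => exact ⟨u, hTw u .nil (by simp), by simp⟩
      | @cons _ y _ h q =>
        refine ⟨y, hTw y q ?_, by simp [h.symm]⟩
        simp only [SimpleGraph.Walk.length_cons] at hp
        omega

/-- The radial function with profile `φ` around the vertex `u`. -/
noncomputable def radialFun (H : SimpleGraph V) (u : V) (φ : ℕ → ℝ) (x : V) : ℝ := by
  classical exact if H.Reachable u x then φ (H.dist u x) else 0

theorem radialFun_of_reachable {H : SimpleGraph V} {u x : V} (φ : ℕ → ℝ) (h : H.Reachable u x) :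
    radialFun H u φ x = φ (H.dist u x) := by
  simp [radialFun, h]

theorem radialFun_of_not_reachable {H : SimpleGraph V} {u x : V} (φ : ℕ → ℝ)
    (h : ¬ H.Reachable u x) : radialFun H u φ x = 0 := by
  simp [radialFun, h]

theorem radialFun_nonneg {H : SimpleGraph V} {u : V} {φ : ℕ → ℝ} (hφ : ∀ i, 0 ≤ φ i) (x : V) :
    0 ≤ radialFun H u φ x := by
  by_cases h : H.Reachable u x
  · rw [radialFun_of_reachable φ h]; exact hφ _
  · rw [radialFun_of_not_reachable φ h]

theorem mul_radialFun_le {H : SimpleGraph V} [DecidableRel H.Adj] {l : ℕ}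
    (hl : ∀ x, (Finset.univ.filter (H.Adj x)).card = l) {θ : ℝ} (hlθ : θ ≤ l) (u : V)
    {φ : ℕ → ℝ} (h0 : φ 0 = 1) (h1 : φ 1 = 1) (hanti : Antitone φ) (hnn : ∀ i, 0 ≤ φ i)
    (hrec : ∀ i, θ * φ (i + 1) ≤ φ i + ((l : ℝ) - 1) * φ (i + 2)) (x : V) :
    θ * radialFun H u φ x ≤ (H.adjMatrix ℝ *ᵥ radialFun H u φ) x := by
  rw [SimpleGraph.adjMatrix_mulVec_apply, SimpleGraph.neighborFinset_eq_filter]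
  by_cases hx : H.Reachable u x
  swap
  · rw [radialFun_of_not_reachable φ hx, mul_zero]
    exact Finset.sum_nonneg fun y _ => radialFun_nonneg hnn y
  have hnb : ∀ y ∈ Finset.univ.filter (H.Adj x), φ (H.dist u x + 1) ≤ radialFun H u φ y := by
    intro y hy
    have hxy : H.Adj x y := by simpa using hy
    rw [radialFun_of_reachable φ (hx.trans hxy.reachable)]
    apply hanti
    obtain ⟨p, hp⟩ := hx.exists_walk_length_eq_dist
    simpa [hp] using SimpleGraph.dist_le (p.concat hxy)
  rw [radialFun_of_reachable φ hx]
  obtain ⟨p, hp⟩ := hx.symm.exists_walk_length_eq_dist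
  rw [SimpleGraph.dist_comm] at hp
  cases p with
  | nil =>
    simp only [SimpleGraph.dist_self, zero_add, h1, h0] at hnb ⊢
    have := Finset.card_nsmul_le_sum _ _ _ hnb
    rw [hl] at this
    simp only [nsmul_eq_mul, mul_one] at this
    linarith
  | @cons _ y _ hxy q =>
    simp only [SimpleGraph.Walk.length_cons] at hp
    have hy : y ∈ Finset.univ.filter (H.Adj x) := by simpa using hxy
    rw [← hp] at hnb ⊢
    rw [← Finset.add_sum_erase _ _ hy]
    have e1 : φ q.length ≤ radialFun H u φ y := by
      rw [radialFun_of_reachable φ (hx.trans hxy.reachable)]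
      apply hanti
      rw [SimpleGraph.dist_comm]
      exact SimpleGraph.dist_le q
    have e2 := Finset.card_nsmul_le_sum ((Finset.univ.filter (H.Adj x)).erase y)
      (radialFun H u φ) _ fun z hz => hnb z (Finset.mem_of_mem_erase hz)
    rw [Finset.card_erase_of_mem hy, hl, nsmul_eq_mul, Nat.cast_sub, Nat.cast_one] at e2
    · exact (hrec _).trans (add_le_add e1 e2)
    · rw [← hl x]
      exact Finset.card_pos.2 ⟨y, hy⟩

theorem ShiftedFormNonneg.compl_form_le {G : SimpleGraph V} [DecidableRel G.Adj] {μ : ℝ}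
    (hG : ShiftedFormNonneg G (μ + 1)) (f : V → ℝ) :
    f ⬝ᵥ (Gᶜ.adjMatrix ℝ *ᵥ f) ≤ (∑ x, f x) ^ 2 + μ * (f ⬝ᵥ f) := by
  have h := hG f
  have hJ : f ⬝ᵥ ((Matrix.of fun _ _ => (1 : ℝ)) *ᵥ f) = (∑ x, f x) ^ 2 := by
    simp [dotProduct, Matrix.mulVec, ← Finset.sum_mul, sq]
  have hJ' : (Matrix.of fun _ _ => (1 : ℝ)) = 1 + G.adjMatrix ℝ + Gᶜ.adjMatrix ℝ := by
    ext i j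
    by_cases hij : i = j
    · subst hij; simp
    · by_cases hadj : G.Adj i j <;>
        simp [SimpleGraph.adjMatrix_apply, hij, hadj]
  rw [hJ', Matrix.add_mulVec, Matrix.add_mulVec, dotProduct_add, dotProduct_add,
    Matrix.one_mulVec] at hJ
  linarith

theorem ShiftedFormNonneg.compl_form_le_of_regular [Nonempty V] {G : SimpleGraph V}
    [DecidableRel G.Adj] {μ : ℝ} (hμ : 0 ≤ μ) (hG : ShiftedFormNonneg G (μ + 1)) {l : ℕ}
    (hl : ∀ x, (Finset.univ.filter (Gᶜ.Adj x)).card = l) (g : V → ℝ) :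
    g ⬝ᵥ (Gᶜ.adjMatrix ℝ *ᵥ g) ≤ μ * (g ⬝ᵥ g) + l * (∑ x, g x) ^ 2 / Fintype.card V := by
  have hv : (0 : ℝ) < Fintype.card V := by exact_mod_cast Fintype.card_pos
  set c : ℝ := (∑ x, g x) / Fintype.card V with hc
  have hcv : c * Fintype.card V = ∑ x, g x := by rw [hc]; field_simp
  have hB1 : Gᶜ.adjMatrix ℝ *ᵥ (fun _ => 1) = fun _ => (l : ℝ) := by
    funext x
    rw [SimpleGraph.adjMatrix_mulVec_apply, SimpleGraph.neighborFinset_eq_filter,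
      Finset.sum_const, hl]
    simp
  have h1B : (fun _ => (1 : ℝ)) ⬝ᵥ (Gᶜ.adjMatrix ℝ *ᵥ g) = l * ∑ x, g x := by
    rw [Matrix.dotProduct_mulVec, ← Matrix.mulVec_transpose, SimpleGraph.transpose_adjMatrix, hB1]
    simp [dotProduct, Finset.mul_sum]
  have h := hG.compl_form_le (g - c • (fun _ : V => (1 : ℝ)))
  have hsum : ∑ x, (g - c • (fun _ : V => (1 : ℝ)) : V → ℝ) x = 0 := by
    simp [Finset.sum_sub_distrib, ← hcv, mul_comm]
  have hgl : g ⬝ᵥ (fun _ => (l : ℝ)) = l * ∑ x, g x := by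
    rw [dotProduct, ← Finset.sum_mul, mul_comm]
  have h1l : (fun _ => (1 : ℝ)) ⬝ᵥ (fun _ : V => (l : ℝ)) = l * Fintype.card V := by
    simp [dotProduct, mul_comm]
  have hg1 : g ⬝ᵥ (fun _ => (1 : ℝ)) = ∑ x, g x := by simp [dotProduct]
  have h1g : (fun _ => (1 : ℝ)) ⬝ᵥ g = ∑ x, g x := by simp [dotProduct]
  have h11 : (fun _ => (1 : ℝ)) ⬝ᵥ (fun _ : V => (1 : ℝ)) = Fintype.card V := by
    simp [dotProduct]
  rw [hsum] at h
  simp only [Matrix.mulVec_sub, Matrix.mulVec_smul, dotProduct_sub, sub_dotProduct,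
    dotProduct_smul, smul_dotProduct, hB1, h1B, hgl, h1l, hg1, h1g, h11, smul_eq_mul] at h
  have hE : (l : ℝ) * (∑ x, g x) ^ 2 / Fintype.card V = l * (c * ∑ x, g x) := by
    rw [hc]; field_simp
  rw [hE]
  have hcc : 0 ≤ c * ∑ x, g x := by
    rw [← hcv]
    have : 0 ≤ c ^ 2 * Fintype.card V := by positivity
    nlinarith
  have := mul_nonneg hμ hcc
  have hcl : c * (l * (Fintype.card V : ℝ)) = l * ∑ x, g x := by rw [← hcv]; ring
  rw [hcl, hcv] at h
  linarith

theorem exists_card_le_of_compl_regular {m l : ℕ} (hm : 0 < m) (hl : m ^ 2 < 4 * ((l : ℝ) - 1)) :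
    ∃ K : ℕ, ∀ (V : Type) [Fintype V] [DecidableEq V] [Nonempty V] (G : SimpleGraph V)
      [DecidableRel G.Adj], ShiftedFormNonneg G (m + 1) →
      (∀ x, (Finset.univ.filter (Gᶜ.Adj x)).card = l) → Fintype.card V ≤ K := by
  have hm' : (0 : ℝ) < m := by exact_mod_cast hm
  obtain ⟨θ, hθ1, hθ2⟩ : ∃ θ : ℝ, (m : ℝ) < θ ∧ θ < √(4 * ((l : ℝ) - 1)) :=
    exists_between (Real.lt_sqrt_of_sq_lt hl)
  have hθ0 : 0 < θ := hm'.trans hθ1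
  have hθsq : θ ^ 2 < 4 * ((l : ℝ) - 1) := (Real.lt_sqrt hθ0.le).1 hθ2
  have hlθ : θ ≤ l := by
    have hl1 : (0 : ℝ) < l := by nlinarith
    refine le_of_lt (lt_of_pow_lt_pow_left₀ 2 hl1.le ?_)
    nlinarith [sq_nonneg ((l : ℝ) - 2)]
  obtain ⟨r, φ, h0, h1, hanti, hnn, hzero, hrec⟩ := exists_radial_profile hθsq
  obtain ⟨K, hK⟩ := exists_nat_ge ((l : ℝ) * (l + 1) ^ r / (θ - m))
  refine ⟨K, fun V _ _ _ G _ hG hreg => ?_⟩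
  obtain ⟨u⟩ := ‹Nonempty V›
  obtain ⟨T, hT, hTw⟩ := Gᶜ.exists_finset_walk_length_le hreg u r
  set g := radialFun Gᶜ u φ with hg
  have hgu : g u = 1 := by rw [hg, radialFun_of_reachable φ (SimpleGraph.Reachable.refl u)]; simp [h0]
  have hgT : ∀ x ∉ T, g x = 0 := by
    intro x hx
    by_cases hux : Gᶜ.Reachable u x
    · rw [hg, radialFun_of_reachable φ hux]
      apply hzero
      by_contra! hlt
      obtain ⟨p, hp⟩ := hux.symm.exists_walk_length_eq_dist
      rw [SimpleGraph.dist_comm] at hp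
      exact hx (hTw x p (by omega))
    · exact radialFun_of_not_reachable φ hux
  have hgg : g ⬝ᵥ g = ∑ x ∈ T, g x ^ 2 := by
    rw [dotProduct, ← Finset.sum_subset (Finset.subset_univ T)]
    · simp [sq]
    · intro x _ hx
      simp [hgT x hx]
  have hsum : ∑ x, g x = ∑ x ∈ T, g x :=
    (Finset.sum_subset (Finset.subset_univ T) fun x _ hx => hgT x hx).symm
  have hlow : θ * (g ⬝ᵥ g) ≤ g ⬝ᵥ (Gᶜ.adjMatrix ℝ *ᵥ g) := by
    rw [dotProduct, dotProduct, Finset.mul_sum]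
    refine Finset.sum_le_sum fun x _ => ?_
    have := mul_le_mul_of_nonneg_left
      (mul_radialFun_le hreg hlθ u h0 h1 hanti hnn hrec x) (radialFun_nonneg (H := Gᶜ) (u := u) hnn x)
    linarith
  have : Nonempty V := ⟨u⟩
  have hup := hG.compl_form_le_of_regular hm'.le hreg g
  have hcs : (∑ x, g x) ^ 2 ≤ (l + 1) ^ r * (g ⬝ᵥ g) := by
    rw [hsum, hgg]
    refine sq_sum_le_card_mul_sum_sq.trans ?_
    refine mul_le_mul_of_nonneg_right ?_ (Finset.sum_nonneg fun x _ => sq_nonneg _)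
    exact_mod_cast hT
  have hggpos : 0 < g ⬝ᵥ g := by
    refine Finset.sum_pos' (fun x _ => mul_self_nonneg _) ⟨u, Finset.mem_univ _, ?_⟩
    rw [hgu]; norm_num
  have hv : (0 : ℝ) < Fintype.card V := by exact_mod_cast Fintype.card_pos
  have hlcs := mul_le_mul_of_nonneg_left hcs (Nat.cast_nonneg (α := ℝ) l)
  have key : (θ - m) * (g ⬝ᵥ g) * Fintype.card V ≤ l * ((l + 1) ^ r * (g ⬝ᵥ g)) := by
    refine le_trans ?_ hlcs
    rw [← le_div_iff₀ hv]
    linarith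
  have hfin : (Fintype.card V : ℝ) * (θ - m) ≤ l * (l + 1) ^ r := by
    refine le_of_mul_le_mul_right ?_ hggpos
    linarith
  have := ((le_div_iff₀ (sub_pos.2 hθ1)).2 hfin).trans hK
  exact_mod_cast this

theorem exists_forall_card_le_of_compl_regular {m : ℕ} (hm : 0 < m) (M : ℕ) :
    ∃ K : ℕ, ∀ l ≤ M, (m : ℝ) ^ 2 < 4 * ((l : ℝ) - 1) →
      ∀ (V : Type) [Fintype V] [DecidableEq V] [Nonempty V] (G : SimpleGraph V)
      [DecidableRel G.Adj], ShiftedFormNonneg G (m + 1) →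
      (∀ x, (Finset.univ.filter (Gᶜ.Adj x)).card = l) → Fintype.card V ≤ K := by
  choose! K hK using fun l hl => exists_card_le_of_compl_regular (m := m) (l := l) hm hl
  refine ⟨(Finset.range (M + 1)).sup K, fun l hlM hl V _ _ _ G _ hG hreg => ?_⟩
  exact (hK l hl V G hG hreg).trans (Finset.le_sup (f := K) (by simpa [Nat.lt_succ_iff] using hlM))

end ComplementDegree

/-- Main theorem: for every integer `λ ≥ 2` there is a constant `C(λ)` such that every
connected sesqui-regular graph with parameters `(v, k, c)`, smallest eigenvalue at
least `−λ` and `k ≥ C(λ)` satisfies `c ≤ λ²(λ−1)` or `v − k − 1 ≤ (λ−1)²/4 + 1`. -/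
theorem stmt19 (lam : ℕ) (hlam : 2 ≤ lam) :
    ∃ Cl : ℕ, ∀ (V : Type) [Fintype V] [DecidableEq V] (G : SimpleGraph V) (v k c : ℕ),
      G.Connected → IsSesquiRegular G v k c → -(lam : ℝ) ≤ graphMinEig G → Cl ≤ k →
      c ≤ lam ^ 2 * (lam - 1) ∨
        (v : ℝ) - k - 1 ≤ ((lam : ℝ) - 1) ^ 2 / 4 + 1 := by
  obtain ⟨m, rfl⟩ : ∃ m, lam = m + 1 := ⟨lam - 1, by omega⟩
  have hm : 0 < m := by omega
  obtain ⟨K₁, hK₁⟩ := exists_forall_commonNeighbors_le_or_card_filter_not_adj_le m hm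
  obtain ⟨K₂, hK₂⟩ := exists_forall_card_le_of_compl_regular hm ((m + 1) * m ^ 2)
  refine ⟨K₁ + K₂ + 1, fun V _ _ G v k c hconn hses hmin hk => ?_⟩
  classical
  obtain ⟨hv, hreg, hcn⟩ := hses
  have hG : ShiftedFormNonneg G (m + 1) := by
    have := shiftedFormNonneg_of_le_graphMinEig G hmin
    push_cast at this
    exact this
  have hreg' : ∀ x, (Finset.univ.filter (G.Adj x)).card = k := by
    intro x
    rw [← hreg x, ← SimpleGraph.neighborFinset_eq_filter, ← Set.ncard_coe_finset]
    simp
  have hc : HasConstCommonNeighbors G c := by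
    intro x y z hxy hadj hxz hyz
    have hd : G.dist x y = 2 := by
      have h1 := hconn.one_lt_dist_of_ne_of_not_adj hxy hadj
      have h2 := SimpleGraph.dist_le (SimpleGraph.Walk.cons hxz (SimpleGraph.Walk.cons hyz.symm .nil))
      simp only [SimpleGraph.Walk.length_cons, SimpleGraph.Walk.length_nil] at h2
      omega
    rw [← hcn x y hd, ← Set.ncard_coe_finset]
    congr 1
    ext w
    simp [SimpleGraph.mem_commonNeighbors]
  rw [Nat.add_sub_cancel]
  refine (hK₁ V G k c hconn hG hc hreg' (by omega)).imp_right fun hl => ?_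
  have : Nonempty V := hconn.nonempty
  have hcompl : ∀ x, (Finset.univ.filter (Gᶜ.Adj x)).card + (k + 1) = v := by
    intro x
    have h1 := Finset.card_filter_add_card_filter_not (s := Finset.univ.erase x)
      (fun y => G.Adj x y)
    have h2 : (Finset.univ.erase x).filter (fun y => G.Adj x y) = Finset.univ.filter (G.Adj x) := by
      ext y
      simpa using fun h : G.Adj x y => h.ne'
    have h3 : (Finset.univ.erase x).filter (fun y => ¬ G.Adj x y) =
        Finset.univ.filter (Gᶜ.Adj x) := by
      ext y
      simp [SimpleGraph.compl_adj, ne_comm]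
    rw [h2, h3, hreg', Finset.card_erase_of_mem (Finset.mem_univ x), Finset.card_univ, hv] at h1
    have : 0 < v := hv ▸ Fintype.card_pos
    omega
  obtain ⟨u⟩ := ‹Nonempty V›
  have hlu : (Finset.univ.filter (Gᶜ.Adj u)).card ≤ (m + 1) * m ^ 2 := by
    refine le_trans (Finset.card_le_card fun y hy => ?_) (hl u)
    simpa [SimpleGraph.compl_adj, ne_comm, eq_comm] using hy
  by_contra! hlt
  have hvu : (v : ℝ) = (Finset.univ.filter (Gᶜ.Adj u)).card + (k + 1) := by
    exact_mod_cast (hcompl u).symm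
  have : Nonempty V := ⟨u⟩
  have hcard := hK₂ _ hlu (by push_cast at hlt; linarith) V G hG fun x => by
    have := hcompl x
    have := hcompl u
    omega
  have := hcompl u
  omega
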